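/- Let n > 2 and (8 - n)/3 < α < 2. Then for every φ ∈ C_c^∞(B ∖ {0}), ∫_B d^α λ^{-n} ( div(λ^{n-2} ∇φ) )² dx ≥ ((n - α)²/4) ∫_B d^{α-2} |∇φ|² λ^{n-2} dx. (In hyperbolic notation: ∫ d^α |Δ_ℍ φ|² dV ≥ ((n-α)²/4) ∫ d^{α-2} |∇_ℍ φ|² dV.) -/

import Mathlib

open MeasureTheory

/-- Conformal factor of the Poincaré ball model. -/
noncomputable def lam {n : ℕ} (x : EuclideanSpace ℝ (Fin n)) : ℝ := 2 / (1 - ‖x‖ ^ 2)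

/-- Hyperbolic distance to the origin in the Poincaré ball model. -/
noncomputable def dH {n : ℕ} (x : EuclideanSpace ℝ (Fin n)) : ℝ :=
  Real.log ((1 + ‖x‖) / (1 - ‖x‖))

/-- Euclidean divergence of a vector field on ℝⁿ. -/
noncomputable def dvg {n : ℕ} (V : EuclideanSpace ℝ (Fin n) → EuclideanSpace ℝ (Fin n))
    (x : EuclideanSpace ℝ (Fin n)) : ℝ :=
  ∑ i, fderiv ℝ V x (EuclideanSpace.single i 1) i

/-- The first term of the power series gives `2 r ≤ log ((1 + r) / (1 - r))`. -/
theorem two_mul_le_log_one_add_div_one_sub {r : ℝ} (h0 : 0 < r) (h1 : r < 1) :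
    2 * r ≤ Real.log ((1 + r) / (1 - r)) := by
  rw [Real.log_div (by linarith) (by linarith)]
  have h := Real.hasSum_log_sub_log_of_abs_lt_one (x := r) (by rw [abs_of_pos h0]; exact h1)
  have := le_hasSum h 0 (fun j _ => by positivity)
  simpa using this

/-- The pointwise inequality behind the Rellich estimate: `D` stands for the divergence of
`λ ^ (n - 2) ∇φ`, `s` for `⟪x, ∇φ⟫`, `G` for `|∇φ|²`, `m` for `λ ^ (n - 2)`, `p` for
`d ^ (α - 2)` and `r` for `|x|`. -/
theorem rellich_pointwise {n α r d p m G s D : ℝ} (hn : 3 ≤ n) (hα₁ : (8 - n) / 3 < α)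
    (hα₂ : α < 2) (hr0 : 0 < r) (hr1 : r < 1) (hd : 2 * r ≤ d) (hp : 0 < p) (hm : 0 < m)
    (hs : s ^ 2 ≤ r ^ 2 * G) :
    (n - α) * (m * (((α - 1) * p / r - p * d * (1 / 2 + 1 / (2 * r ^ 2))) / r +
          (n - 2) * (2 / (1 - r ^ 2)) * (p * d * ((1 - r ^ 2) / (2 * r)))) *
            (s ^ 2 - G * r ^ 2 / 2) +
        m * (p * d * ((1 - r ^ 2) / (2 * r))) * (G - n * G / 2) +
        p * d * ((1 - r ^ 2) / (2 * r)) * s * (D - (n - 2) * m * (2 / (1 - r ^ 2)) * s)) ≤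
      p * d ^ 2 * (((1 - r ^ 2) / 2) ^ 2 / m) * D ^ 2 - (n - α) ^ 2 / 4 * (p * G * m) := by
  have he : 0 < 1 - r ^ 2 := by nlinarith
  have hK : 0 ≤ d * (1 + r ^ 2) / (2 * r) - 1 := by
    rw [sub_nonneg, le_div_iff₀ (by positivity)]
    nlinarith [sq_nonneg r]
  have hT : 0 ≤ G - s ^ 2 / r ^ 2 := by
    rw [sub_nonneg, div_le_iff₀ (by positivity)]
    linarith
  have key : p * d ^ 2 * (((1 - r ^ 2) / 2) ^ 2 / m) * D ^ 2 - (n - α) ^ 2 / 4 * (p * G * m) -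
      (n - α) * (m * (((α - 1) * p / r - p * d * (1 / 2 + 1 / (2 * r ^ 2))) / r +
          (n - 2) * (2 / (1 - r ^ 2)) * (p * d * ((1 - r ^ 2) / (2 * r)))) *
            (s ^ 2 - G * r ^ 2 / 2) +
        m * (p * d * ((1 - r ^ 2) / (2 * r))) * (G - n * G / 2) +
        p * d * ((1 - r ^ 2) / (2 * r)) * s * (D - (n - 2) * m * (2 / (1 - r ^ 2)) * s)) =
      p / m * (d * ((1 - r ^ 2) / 2) * D - (n - α) / 2 * m * s / r) ^ 2 +
      (n - α) * m * p * ((n - 1) * (d * (1 + r ^ 2) / (2 * r) - 1) / 2 * (s ^ 2 / r ^ 2) +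
        ((n - 3) * (d * (1 + r ^ 2) / (2 * r) - 1) / 2 + (3 * α + n - 8) / 4) *
          (G - s ^ 2 / r ^ 2)) := by
    field_simp
    ring
  have h1 : 0 ≤ n - α := by linarith
  have h2 : 0 ≤ n - 1 := by linarith
  have h3 : 0 ≤ n - 3 := by linarith
  have h4 : 0 ≤ 3 * α + n - 8 := by linarith
  rw [← sub_nonneg, key]
  generalize d * (1 + r ^ 2) / (2 * r) - 1 = K at hK ⊢
  generalize G - s ^ 2 / r ^ 2 = T at hT ⊢
  positivity

section helpers

variable {n : ℕ}

theorem hasFDerivAt_norm_of_ne_zero {x : EuclideanSpace ℝ (Fin n)} (hx : x ≠ 0) :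
    HasFDerivAt (fun y : EuclideanSpace ℝ (Fin n) => ‖y‖) (‖x‖⁻¹ • innerSL ℝ x) x := by
  have h := (hasStrictFDerivAt_norm_sq x).hasFDerivAt.sqrt (by simpa using hx)
  have hx' : ‖x‖ ≠ 0 := by simpa using hx
  convert! h using 1
  · ext y; simp
  · ext y
    simp
    field_simp

theorem hasFDerivAt_comp_norm {f : ℝ → ℝ} {f' : ℝ} {x : EuclideanSpace ℝ (Fin n)} (hx : x ≠ 0)
    (hf : HasDerivAt f f' ‖x‖) :
    HasFDerivAt (fun y : EuclideanSpace ℝ (Fin n) => f ‖y‖) ((f' / ‖x‖) • innerSL ℝ x) x := by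
  have h := hf.comp_hasFDerivAt x (hasFDerivAt_norm_of_ne_zero hx)
  rwa [smul_smul, ← div_eq_mul_inv] at h

theorem hasDerivAt_two_div_one_sub_sq_rpow (b : ℝ) {r : ℝ} (h0 : 0 < r) (h1 : r < 1) :
    HasDerivAt (fun t : ℝ => (2 / (1 - t ^ 2)) ^ b)
      (b * (2 / (1 - r ^ 2)) ^ b * (2 / (1 - r ^ 2)) * r) r := by
  have he : 0 < 1 - r ^ 2 := by nlinarith
  have hl : 0 < 2 / (1 - r ^ 2) := by positivity
  have h := (((hasDerivAt_pow 2 r).const_sub 1).inv he.ne').const_mul 2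
  have h' := h.rpow_const (p := b) (Or.inl (by simpa [← div_eq_mul_inv] using hl.ne'))
  convert! h' using 1
  simp only [← div_eq_mul_inv, Pi.inv_apply]
  rw [Real.rpow_sub_one hl.ne']
  field_simp
  ring

theorem hasDerivAt_log_one_add_div_one_sub {r : ℝ} (h0 : 0 < r) (h1 : r < 1) :
    HasDerivAt (fun t : ℝ => Real.log ((1 + t) / (1 - t))) (2 / (1 - r ^ 2)) r := by
  have he : 0 < 1 - r := by linarith
  have h := ((hasDerivAt_id r).const_add 1).div ((hasDerivAt_id r).const_sub 1) he.ne'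
  convert! h.log (div_pos (by simp; linarith) (by simpa using he)).ne' using 1
  have : 1 - r ^ 2 ≠ 0 := by nlinarith
  have : 1 + r ≠ 0 := by linarith
  simp
  field_simp
  ring

/-- The radial weight `d ^ (α - 1) / (λ |x|)` and its derivative. -/
theorem hasDerivAt_radial_weight (α : ℝ) {r : ℝ} (h0 : 0 < r) (h1 : r < 1) :
    HasDerivAt
      (fun t : ℝ => Real.log ((1 + t) / (1 - t)) ^ (α - 1) * ((1 - t ^ 2) / (2 * t)))
      ((α - 1) * Real.log ((1 + r) / (1 - r)) ^ (α - 2) / r -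
        Real.log ((1 + r) / (1 - r)) ^ (α - 2) * Real.log ((1 + r) / (1 - r)) *
          (1 / 2 + 1 / (2 * r ^ 2))) r := by
  have hd : 0 < Real.log ((1 + r) / (1 - r)) := by
    linarith [two_mul_le_log_one_add_div_one_sub h0 h1]
  have he : 1 - r ^ 2 ≠ 0 := by nlinarith
  have hA := (hasDerivAt_log_one_add_div_one_sub h0 h1).rpow_const (p := α - 1) (Or.inl hd.ne')
  have hB := ((hasDerivAt_pow 2 r).const_sub 1).div ((hasDerivAt_id r).const_mul 2)
    (by simpa using h0.ne')
  convert! hA.mul hB using 1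
  have e : Real.log ((1 + r) / (1 - r)) ^ (α - 1) =
      Real.log ((1 + r) / (1 - r)) ^ (α - 2) * Real.log ((1 + r) / (1 - r)) := by
    rw [← Real.rpow_add_one hd.ne']; ring_nf
  have e2 : α - 1 - 1 = α - 2 := by ring
  simp only [e, e2, id, Pi.div_apply]
  field_simp
  ring

theorem integral_fderiv_apply_eq_zero {f : EuclideanSpace ℝ (Fin n) → ℝ}
    (v : EuclideanSpace ℝ (Fin n))
    (hf : Differentiable ℝ f) (hi : Integrable f) (hi' : Integrable (fun x => fderiv ℝ f x v)) :
    ∫ x, fderiv ℝ f x v = 0 := by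
  have h := integral_bilinear_hasLineDerivAt_right_eq_neg_left_of_integrable (μ := volume)
    (f := fun _ : EuclideanSpace ℝ (Fin n) => (1 : ℝ)) (f' := fun _ => 0) (g := f)
    (g' := fun x => fderiv ℝ f x v) (v := v) (B := ContinuousLinearMap.mul ℝ ℝ)
    (by simp) (by simpa using hi') (by simpa using hi)
    (fun x _ => by simpa using (hasFDerivAt_const (1 : ℝ) x).hasLineDerivAt v)
    (fun x _ => (hf x).hasFDerivAt.hasLineDerivAt v)
  simpa using h

/-- A function that is continuous at the points of a compact set and vanishes off it is
integrable. -/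
theorem integrable_of_continuousAt_of_eq_zero {f : EuclideanSpace ℝ (Fin n) → ℝ}
    {K : Set (EuclideanSpace ℝ (Fin n))} (hK : IsCompact K) (hc : ∀ x ∈ K, ContinuousAt f x)
    (h0 : ∀ x ∉ K, f x = 0) : Integrable f := by
  have h : IntegrableOn f K :=
    (ContinuousOn.integrableOn_compact hK fun x hx => (hc x hx).continuousWithinAt)
  exact (integrableOn_iff_integrable_of_support_subset
    (fun x hx => by_contra fun hxK => hx (h0 x hxK))).1 h

theorem sum_inner_map_mul (L : EuclideanSpace ℝ (Fin n) →L[ℝ] EuclideanSpace ℝ (Fin n))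
    (u v : EuclideanSpace ℝ (Fin n)) :
    ∑ i, inner ℝ u (L (EuclideanSpace.single i 1)) * v i = inner ℝ u (L v) := by
  have hv : v = ∑ i, v i • EuclideanSpace.single i (1 : ℝ) := by
    ext j; simp [Finset.sum_apply, Pi.single_apply]
  conv_rhs => rw [hv]
  simp [inner_sum, inner_smul_right, mul_comm]

theorem inner_fderiv_gradient_symm {φ : EuclideanSpace ℝ (Fin n) → ℝ} (hφ : ContDiff ℝ 2 φ)
    (hg : Differentiable ℝ (gradient φ)) (x u v : EuclideanSpace ℝ (Fin n)) :
    inner ℝ (fderiv ℝ (gradient φ) x u) v = inner ℝ u (fderiv ℝ (gradient φ) x v) := by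
  have key : ∀ u v, inner ℝ (fderiv ℝ (gradient φ) x u) v = fderiv ℝ (fderiv ℝ φ) x u v := by
    intro u v
    have e : fderiv ℝ φ = fun y => InnerProductSpace.toDual ℝ _ (gradient φ y) := by
      ext y; simp [gradient]
    have h := ((InnerProductSpace.toDual ℝ (EuclideanSpace ℝ (Fin n))).toContinuousLinearEquiv
      |>.toContinuousLinearMap).hasFDerivAt.comp x (hg x).hasFDerivAt
    rw [e]
    erw [h.fderiv]
    simp
  rw [real_inner_comm v, real_inner_comm, key, real_inner_comm, key]
  exact (hφ.contDiffAt.isSymmSndFDerivAt (by simp)) u v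

theorem dvg_eq {V : EuclideanSpace ℝ (Fin n) → EuclideanSpace ℝ (Fin n)}
    {V' : EuclideanSpace ℝ (Fin n) →L[ℝ] EuclideanSpace ℝ (Fin n)} {x : EuclideanSpace ℝ (Fin n)}
    (h : HasFDerivAt V V' x) : dvg V x = ∑ i, V' (EuclideanSpace.single i 1) i := by
  rw [dvg, h.fderiv]

theorem dvg_smul {m : EuclideanSpace ℝ (Fin n) → ℝ} {a : ℝ}
    {g : EuclideanSpace ℝ (Fin n) → EuclideanSpace ℝ (Fin n)}
    {L : EuclideanSpace ℝ (Fin n) →L[ℝ] EuclideanSpace ℝ (Fin n)} {x : EuclideanSpace ℝ (Fin n)}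
    (hm : HasFDerivAt m (a • innerSL ℝ x) x) (hg : HasFDerivAt g L x) :
    dvg (fun y => m y • g y) x = a * inner ℝ x (g x) + m x * dvg g x := by
  rw [dvg_eq (V := fun y => m y • g y) (hm.smul hg), dvg_eq hg]
  simp only [add_apply, smul_apply,
    ContinuousLinearMap.smulRight_apply, innerSL_apply_apply, PiLp.add_apply, PiLp.smul_apply,
    smul_eq_mul, Finset.sum_add_distrib, ← Finset.mul_sum, mul_assoc]
  have h := sum_inner_map_mul (ContinuousLinearMap.id ℝ _) x (g x)
  simp only [ContinuousLinearMap.id_apply] at h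
  rw [h]
  ring

/-- The vector field whose divergence gives the Pohozaev identity with radial weight `k`. -/
noncomputable def pohozaevField (k : EuclideanSpace ℝ (Fin n) → ℝ)
    (g : EuclideanSpace ℝ (Fin n) → EuclideanSpace ℝ (Fin n)) (y : EuclideanSpace ℝ (Fin n)) :
    EuclideanSpace ℝ (Fin n) :=
  k y • (inner ℝ y (g y) • g y - (‖g y‖ ^ 2 / 2) • y)

theorem contDiffAt_pohozaevField {k : EuclideanSpace ℝ (Fin n) → ℝ}
    {g : EuclideanSpace ℝ (Fin n) → EuclideanSpace ℝ (Fin n)} {x : EuclideanSpace ℝ (Fin n)}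
    (hk : ContDiffAt ℝ 1 k x) (hg : ContDiffAt ℝ 1 g x) :
    ContDiffAt ℝ 1 (pohozaevField k g) x :=
  hk.smul (((contDiffAt_id.inner ℝ hg).smul hg).sub
    (((hg.norm_sq ℝ).div_const 2).smul contDiffAt_id))

theorem dvg_pohozaevField {k : EuclideanSpace ℝ (Fin n) → ℝ} {c : ℝ}
    {g : EuclideanSpace ℝ (Fin n) → EuclideanSpace ℝ (Fin n)}
    {L : EuclideanSpace ℝ (Fin n) →L[ℝ] EuclideanSpace ℝ (Fin n)} {x : EuclideanSpace ℝ (Fin n)}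
    (hk : HasFDerivAt k (c • innerSL ℝ x) x) (hg : HasFDerivAt g L x)
    (hL : ∀ u v, inner ℝ (L u) v = inner ℝ u (L v)) :
    dvg (pohozaevField k g) x =
      c * (inner ℝ x (g x) ^ 2 - ‖g x‖ ^ 2 * ‖x‖ ^ 2 / 2) +
        k x * (‖g x‖ ^ 2 - n * ‖g x‖ ^ 2 / 2) + k x * inner ℝ x (g x) * dvg g x := by
  have hid := hasFDerivAt_id (𝕜 := ℝ) x
  have h := hk.smul (((hid.inner ℝ hg).smul hg).sub
    ((hg.norm_sq.mul_const (2⁻¹ : ℝ)).smul hid))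
  obtain ⟨V', h, hV⟩ : ∃ V' : EuclideanSpace ℝ (Fin n) →L[ℝ] EuclideanSpace ℝ (Fin n),
      HasFDerivAt (pohozaevField k g) V' x ∧ ∀ v, V' v =
        (c * inner ℝ x v) • (inner ℝ x (g x) • g x - (‖g x‖ ^ 2 / 2) • x) +
        k x • (inner ℝ x (g x) • L v + (inner ℝ x (L v) + inner ℝ (g x) v) • g x -
          (‖g x‖ ^ 2 / 2) • v - inner ℝ (g x) (L v) • x) := by
    refine ⟨_, h.congr_of_eventuallyEq (.of_forall fun y => ?_), fun v => ?_⟩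
    · simp [pohozaevField, div_eq_mul_inv]
    · ext i
      simp [real_inner_comm]
      ring
  have h1 := sum_inner_map_mul (ContinuousLinearMap.id ℝ _) x (g x)
  have h2 := sum_inner_map_mul (ContinuousLinearMap.id ℝ _) x x
  have h3 := sum_inner_map_mul (ContinuousLinearMap.id ℝ _) (g x) (g x)
  have h4 := sum_inner_map_mul L x (g x)
  have h5 := sum_inner_map_mul L (g x) x
  rw [← hL, real_inner_comm, real_inner_comm, real_inner_comm] at h5
  simp only [ContinuousLinearMap.id_apply, real_inner_self_eq_norm_sq] at h1 h2 h3
  have key : ∀ i, V' (EuclideanSpace.single i 1) i =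
      c * inner ℝ x (g x) * (inner ℝ x (EuclideanSpace.single i 1) * g x i) -
      c * (‖g x‖ ^ 2 / 2) * (inner ℝ x (EuclideanSpace.single i 1) * x i) +
      k x * inner ℝ x (g x) * (L (EuclideanSpace.single i 1) i) +
      k x * (inner ℝ x (L (EuclideanSpace.single i 1)) * g x i) +
      k x * (inner ℝ (g x) (EuclideanSpace.single i 1) * g x i) -
      k x * (inner ℝ (g x) (L (EuclideanSpace.single i 1)) * x i) -
      k x * (‖g x‖ ^ 2 / 2) := by
    intro i
    rw [hV]
    simp
    ring
  rw [dvg_eq h, dvg_eq hg]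
  simp only [key, Finset.sum_add_distrib, Finset.sum_sub_distrib, ← Finset.mul_sum, h1, h2, h3,
    h4, h5]
  simp
  ring

theorem continuousAt_dvg {V : EuclideanSpace ℝ (Fin n) → EuclideanSpace ℝ (Fin n)}
    {x : EuclideanSpace ℝ (Fin n)} (hV : ContDiffAt ℝ 1 V x) : ContinuousAt (dvg V) x := by
  have h : ContinuousAt (fderiv ℝ V) x := (hV.fderiv_right (m := 0) (by simp)).continuousAt
  unfold dvg
  fun_prop

theorem integral_dvg_eq_zero {V : EuclideanSpace ℝ (Fin n) → EuclideanSpace ℝ (Fin n)}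
    (hV : ContDiff ℝ 1 V) (hc : HasCompactSupport V) : ∫ x, dvg V x = 0 := by
  have hVd : Differentiable ℝ V := hV.differentiable (by simp)
  have hfd : Continuous (fderiv ℝ V) := hV.continuous_fderiv (by simp)
  have e : ∀ (i : Fin n) (x v : EuclideanSpace ℝ (Fin n)),
      fderiv ℝ (fun y => V y i) x v = fderiv ℝ V x v i := by
    intro i x v
    have h := (EuclideanSpace.proj i : EuclideanSpace ℝ (Fin n) →L[ℝ] ℝ).hasFDerivAt.comp x
      (hVd x).hasFDerivAt
    rw [show (fun y => V y i) = (EuclideanSpace.proj i : EuclideanSpace ℝ (Fin n) →L[ℝ] ℝ) ∘ V from rfl,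
      h.fderiv]
    rfl
  have hi : ∀ i : Fin n, Integrable
      (fun x => fderiv ℝ V x (EuclideanSpace.single i 1) i) := by
    intro i
    refine Continuous.integrable_of_hasCompactSupport (by fun_prop) ?_
    exact (hc.fderiv ℝ).comp_left
      (g := fun L : EuclideanSpace ℝ (Fin n) →L[ℝ] EuclideanSpace ℝ (Fin n) =>
        L (EuclideanSpace.single i 1) i) (by simp)
  unfold dvg
  rw [integral_finsetSum _ fun i _ => hi i]
  refine Finset.sum_eq_zero fun i _ => ?_
  have h := integral_fderiv_apply_eq_zero (f := fun y => V y i) (EuclideanSpace.single i 1)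
    (by fun_prop)
    (Continuous.integrable_of_hasCompactSupport (by fun_prop)
      (hc.comp_left (g := fun w : EuclideanSpace ℝ (Fin n) => w i) (by simp)))
    (by simpa only [e] using hi i)
  simpa only [e] using h

/-- The radial weight `λ ^ (n - 2) d ^ (α - 1) / (λ |x|)`. -/
noncomputable def rellichWeight (α : ℝ) (y : EuclideanSpace ℝ (Fin n)) : ℝ :=
  lam y ^ ((n : ℝ) - 2) * (dH y ^ (α - 1) * ((1 - ‖y‖ ^ 2) / (2 * ‖y‖)))

section weights

variable {x : EuclideanSpace ℝ (Fin n)}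

theorem lam_pos (hx : ‖x‖ < 1) : 0 < lam x := by
  have : 0 < 1 - ‖x‖ ^ 2 := by nlinarith [norm_nonneg x]
  unfold lam
  positivity

theorem two_mul_norm_le_dH (hx0 : x ≠ 0) (hx : ‖x‖ < 1) : 2 * ‖x‖ ≤ dH x :=
  two_mul_le_log_one_add_div_one_sub (norm_pos_iff.2 hx0) hx

theorem dH_pos (hx0 : x ≠ 0) (hx : ‖x‖ < 1) : 0 < dH x := by
  linarith [two_mul_norm_le_dH hx0 hx, norm_pos_iff.2 hx0]

theorem contDiffAt_lam (hx : ‖x‖ < 1) : ContDiffAt ℝ 1 lam x :=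
  contDiffAt_const.div (contDiffAt_const.sub (contDiffAt_id.norm_sq ℝ))
    (by nlinarith [norm_nonneg x])

theorem contDiffAt_dH (hx0 : x ≠ 0) (hx : ‖x‖ < 1) : ContDiffAt ℝ 1 dH x := by
  have h := contDiffAt_norm ℝ (n := 1) hx0
  have h1 : 0 < 1 - ‖x‖ := by linarith
  exact ((contDiffAt_const.add h).div (contDiffAt_const.sub h) h1.ne').log
    (div_pos (by positivity) h1).ne'

theorem contDiffAt_rellichWeight (α : ℝ) (hx0 : x ≠ 0) (hx : ‖x‖ < 1) :
    ContDiffAt ℝ 1 (rellichWeight α) x :=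
  ((contDiffAt_lam hx).rpow_const_of_ne (lam_pos hx).ne').mul
    (((contDiffAt_dH hx0 hx).rpow_const_of_ne (dH_pos hx0 hx).ne').mul
      ((contDiffAt_const.sub (contDiffAt_id.norm_sq ℝ)).div
        (contDiffAt_const.mul (contDiffAt_norm ℝ hx0)) (by simpa using hx0)))

theorem hasFDerivAt_lam_rpow (b : ℝ) (hx0 : x ≠ 0) (hx : ‖x‖ < 1) :
    HasFDerivAt (fun y : EuclideanSpace ℝ (Fin n) => lam y ^ b)
      ((b * lam x ^ b * lam x) • innerSL ℝ x) x := by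
  have h0 := norm_pos_iff.2 hx0
  have h := hasFDerivAt_comp_norm hx0 (hasDerivAt_two_div_one_sub_sq_rpow b h0 hx)
  rwa [mul_div_cancel_right₀ _ h0.ne'] at h

theorem hasFDerivAt_rellichWeight (α : ℝ) (hx0 : x ≠ 0) (hx : ‖x‖ < 1) :
    HasFDerivAt (rellichWeight α)
      ((lam x ^ ((n : ℝ) - 2) *
        (((α - 1) * dH x ^ (α - 2) / ‖x‖ -
            dH x ^ (α - 2) * dH x * (1 / 2 + 1 / (2 * ‖x‖ ^ 2))) / ‖x‖ +
          ((n : ℝ) - 2) * lam x *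
            (dH x ^ (α - 2) * dH x * ((1 - ‖x‖ ^ 2) / (2 * ‖x‖))))) • innerSL ℝ x) x := by
  have h0 := norm_pos_iff.2 hx0
  have h := (hasFDerivAt_lam_rpow ((n : ℝ) - 2) hx0 hx).mul
    (hasFDerivAt_comp_norm hx0 (hasDerivAt_radial_weight α h0 hx))
  refine h.congr_fderiv ?_
  have e : dH x ^ (α - 2) * dH x = dH x ^ (α - 1) := by
    rw [← Real.rpow_add_one (dH_pos hx0 hx).ne']; ring_nf
  have ed : Real.log ((1 + ‖x‖) / (1 - ‖x‖)) = dH x := rfl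
  rw [smul_smul, smul_smul, ← add_smul, ed, e]
  congr 1
  ring

end weights

theorem gradient_eventuallyEq_zero {φ : EuclideanSpace ℝ (Fin n) → ℝ}
    {x : EuclideanSpace ℝ (Fin n)} (hx : x ∉ tsupport φ) :
    gradient φ =ᶠ[nhds x] fun _ => 0 := by
  have h : φ =ᶠ[nhds x] fun _ => 0 := notMem_tsupport_iff_eventuallyEq.1 hx
  filter_upwards [h.gradient] with y hy
  rw [hy, gradient_fun_const]

theorem dvg_eq_zero_of_eventuallyEq {V : EuclideanSpace ℝ (Fin n) → EuclideanSpace ℝ (Fin n)}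
    {x : EuclideanSpace ℝ (Fin n)} (h : V =ᶠ[nhds x] fun _ => 0) : dvg V x = 0 := by
  simp [dvg, h.fderiv_eq]

theorem ContDiff.gradient_of_succ {φ : EuclideanSpace ℝ (Fin n) → ℝ} (hφ : ContDiff ℝ 2 φ) :
    ContDiff ℝ 1 (gradient φ) :=
  (InnerProductSpace.toDual ℝ (EuclideanSpace ℝ (Fin n))).symm.contDiff.comp
    (hφ.fderiv_right (m := 1) (by norm_num))

end helpers

/-- Sharp weighted Rellich-type inequality on hyperbolic space (Theorem 3.2, inequality). -/
theorem weighted_rellich_hyperbolic {n : ℕ} (hn : 2 < n)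
    (α : ℝ) (hα₁ : (8 - (n : ℝ)) / 3 < α) (hα₂ : α < 2)
    (φ : EuclideanSpace ℝ (Fin n) → ℝ)
    (hφ_smooth : ContDiff ℝ (⊤ : ℕ∞) φ) (hφ_cpt : HasCompactSupport φ)
    (hφ_supp : tsupport φ ⊆ Metric.ball (0 : EuclideanSpace ℝ (Fin n)) 1 \ {0}) :
    ((n : ℝ) - α) ^ 2 / 4 *
        ∫ x in Metric.ball (0 : EuclideanSpace ℝ (Fin n)) 1,
          dH x ^ (α - 2) * ‖gradient φ x‖ ^ 2 * lam x ^ ((n : ℝ) - 2) ≤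
      ∫ x in Metric.ball (0 : EuclideanSpace ℝ (Fin n)) 1,
        dH x ^ α * lam x ^ (-(n : ℝ)) *
          (dvg (fun y => lam y ^ ((n : ℝ) - 2) • gradient φ y) x) ^ 2 := by
  have hK : ∀ x ∈ tsupport φ, x ≠ 0 ∧ ‖x‖ < 1 := fun x hx =>
    ⟨(hφ_supp hx).2, by simpa using (hφ_supp hx).1⟩
  have hφ2 : ContDiff ℝ 2 φ := contDiff_infty.1 hφ_smooth 2
  have hg : ContDiff ℝ 1 (gradient φ) := hφ2.gradient_of_succ
  have hgd : Differentiable ℝ (gradient φ) := hg.differentiable (by simp)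
  have hg0 : ∀ x ∉ tsupport φ, gradient φ x = 0 := fun x hx =>
    (gradient_eventuallyEq_zero hx).self_of_nhds
  have hV0 : ∀ x ∉ tsupport φ, pohozaevField (rellichWeight α) (gradient φ) =ᶠ[nhds x]
      fun _ => 0 := fun x hx => by
    filter_upwards [gradient_eventuallyEq_zero hx] with y hy
    simp [pohozaevField, hy]
  have hD0 : ∀ x ∉ tsupport φ, dvg (fun y => lam y ^ ((n : ℝ) - 2) • gradient φ y) x = 0 :=
    fun x hx => dvg_eq_zero_of_eventuallyEq <| by
      filter_upwards [gradient_eventuallyEq_zero hx] with y hy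
      simp [hy]
  have hlam : ∀ b : ℝ, ∀ x ∈ tsupport φ, ContDiffAt ℝ 1 (fun y => lam y ^ b) x := fun b x hx =>
    (contDiffAt_lam (hK x hx).2).rpow_const_of_ne (lam_pos (hK x hx).2).ne'
  have hdH : ∀ b : ℝ, ∀ x ∈ tsupport φ, ContDiffAt ℝ 1 (fun y => dH y ^ b) x := fun b x hx =>
    (contDiffAt_dH (hK x hx).1 (hK x hx).2).rpow_const_of_ne (dH_pos (hK x hx).1 (hK x hx).2).ne'
  have hV : ContDiff ℝ 1 (pohozaevField (rellichWeight α) (gradient φ)) := by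
    rw [contDiff_iff_contDiffAt]
    intro x
    by_cases hx : x ∈ tsupport φ
    · exact contDiffAt_pohozaevField (contDiffAt_rellichWeight α (hK x hx).1 (hK x hx).2)
        hg.contDiffAt
    · exact contDiffAt_const.congr_of_eventuallyEq (hV0 x hx)
  have hVc : HasCompactSupport (pohozaevField (rellichWeight α) (gradient φ)) :=
    HasCompactSupport.intro hφ_cpt fun x hx => (hV0 x hx).self_of_nhds
  have hL0 : ∀ x ∉ tsupport φ,
      dH x ^ (α - 2) * ‖gradient φ x‖ ^ 2 * lam x ^ ((n : ℝ) - 2) = 0 := fun x hx => by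
    simp [hg0 x hx]
  have hR0 : ∀ x ∉ tsupport φ, dH x ^ α * lam x ^ (-(n : ℝ)) *
      (dvg (fun y => lam y ^ ((n : ℝ) - 2) • gradient φ y) x) ^ 2 = 0 := fun x hx => by
    simp [hD0 x hx]
  have hLi : Integrable fun x : EuclideanSpace ℝ (Fin n) =>
      dH x ^ (α - 2) * ‖gradient φ x‖ ^ 2 * lam x ^ ((n : ℝ) - 2) :=
    integrable_of_continuousAt_of_eq_zero hφ_cpt (fun x hx =>
      ((hdH _ x hx).continuousAt.mul (hg.continuous.norm.pow 2).continuousAt).mul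
        (hlam _ x hx).continuousAt) hL0
  have hRi : Integrable fun x : EuclideanSpace ℝ (Fin n) => dH x ^ α * lam x ^ (-(n : ℝ)) *
      (dvg (fun y => lam y ^ ((n : ℝ) - 2) • gradient φ y) x) ^ 2 :=
    integrable_of_continuousAt_of_eq_zero hφ_cpt (fun x hx =>
      ((hdH _ x hx).continuousAt.mul (hlam _ x hx).continuousAt).mul
        ((continuousAt_dvg ((hlam _ x hx).smul hg.contDiffAt)).pow 2)) hR0
  have hVi : Integrable (dvg (pohozaevField (rellichWeight α) (gradient φ))) :=
    integrable_of_continuousAt_of_eq_zero hφ_cpt (fun x _ => continuousAt_dvg hV.contDiffAt)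
      fun x hx => dvg_eq_zero_of_eventuallyEq (hV0 x hx)
  have hball : ∀ x ∉ Metric.ball (0 : EuclideanSpace ℝ (Fin n)) 1, x ∉ tsupport φ :=
    fun x hx hxK => hx (hφ_supp hxK).1
  rw [setIntegral_eq_integral_of_forall_compl_eq_zero fun x hx => hL0 x (hball x hx),
    setIntegral_eq_integral_of_forall_compl_eq_zero fun x hx => hR0 x (hball x hx),
    ← integral_const_mul, ← sub_nonneg, ← integral_sub hRi (hLi.const_mul _)]
  have hzero : ∫ x, ((n : ℝ) - α) * dvg (pohozaevField (rellichWeight α) (gradient φ)) x = 0 := by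
    rw [integral_const_mul, integral_dvg_eq_zero hV hVc, mul_zero]
  rw [← hzero]
  refine integral_mono (hVi.const_mul _) (hRi.sub (hLi.const_mul _)) fun x => ?_
  by_cases hx : x ∈ tsupport φ
  swap
  · simp only [hL0 x hx, hR0 x hx, dvg_eq_zero_of_eventuallyEq (hV0 x hx), mul_zero, sub_zero,
      le_refl]
  obtain ⟨hx0, hx1⟩ := hK x hx
  have hr := norm_pos_iff.2 hx0
  have hd := dH_pos hx0 hx1
  have hl := lam_pos hx1
  have hD := dvg_smul (hasFDerivAt_lam_rpow ((n : ℝ) - 2) hx0 hx1) (hgd x).hasFDerivAt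
  have hP := dvg_pohozaevField (hasFDerivAt_rellichWeight α hx0 hx1) (hgd x).hasFDerivAt
    (inner_fderiv_gradient_symm hφ2 hgd x)
  have hs : inner ℝ x (gradient φ x) ^ 2 ≤ ‖x‖ ^ 2 * ‖gradient φ x‖ ^ 2 := by
    rw [← mul_pow, ← sq_abs]
    exact pow_le_pow_left₀ (abs_nonneg _) (abs_real_inner_le_norm _ _) 2
  have hmain := rellich_pointwise (n := n) (m := lam x ^ ((n : ℝ) - 2)) (p := dH x ^ (α - 2))
    (D := dvg (fun y => lam y ^ ((n : ℝ) - 2) • gradient φ y) x)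
    (by exact_mod_cast hn) hα₁ hα₂ hr hx1 (two_mul_norm_le_dH hx0 hx1)
    (Real.rpow_pos_of_pos hd _) (Real.rpow_pos_of_pos hl _) hs
  have e1 : dH x ^ (α - 1) = dH x ^ (α - 2) * dH x := by
    rw [← Real.rpow_add_one hd.ne']; ring_nf
  have e2 : dH x ^ α = dH x ^ (α - 2) * dH x ^ 2 := by
    rw [← Real.rpow_add_natCast hd.ne']; norm_num
  have e3 : lam x ^ (-(n : ℝ)) = ((1 - ‖x‖ ^ 2) / 2) ^ 2 / lam x ^ ((n : ℝ) - 2) := by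
    have e : (1 - ‖x‖ ^ 2) / 2 = (lam x)⁻¹ := by rw [lam, inv_div]
    rw [e, Real.rpow_neg hl.le, Real.rpow_sub hl, Real.rpow_ofNat]
    field_simp
  have e4 : 2 / (1 - ‖x‖ ^ 2) = lam x := rfl
  rw [e4] at hmain
  rw [hD] at hmain
  simp only [hP, hD, e2, e3]
  simp only [rellichWeight, e1]
  refine le_of_eq_of_le ?_ (hmain.trans_eq ?_) <;> ring
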